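/- Consider the complete k-ary tree T with ℓ levels of nodes, true leaf counts x, the consistent node counts H(x), and h̃ = H(x) + η with η having i.i.d. coordinates distributed as Laplace with scale ℓ/ε (variance 2ℓ²/ε²). Let h̄ be the minimum L2 consistent solution for h̃. Then for every range query q over a contiguous interval of leaves, the estimate h̄_q = Σ_{u ∈ R} h̄[u] satisfies E[(h̄_q − q(x))²] ≤ kℓ · (2ℓ²/ε²) = 2kℓ³/ε²; in particular the error of h̄_q is O(ℓ³/ε²). -/

import Mathlib

open MeasureTheory

/-- A node of the complete `k`-ary tree with `ℓ` levels of nodes. -/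
abbrev TreeNode (k ℓ : ℕ) : Type := Σ d : Fin ℓ, Fin (k ^ (d : ℕ))

/-- The node at depth `d` with index `j`. -/
def mkNode {k ℓ : ℕ} (d : ℕ) (hd : d < ℓ) (j : Fin (k ^ d)) : TreeNode k ℓ := ⟨⟨d, hd⟩, j⟩

/-- The `r`-th child of the node at depth `d` with index `j`. -/
def childNode {k ℓ : ℕ} (d : ℕ) (hd : d + 1 < ℓ) (j : Fin (k ^ d)) (r : Fin k) :
    TreeNode k ℓ :=
  ⟨⟨d + 1, hd⟩, ⟨(j : ℕ) * k + (r : ℕ), by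
    have hj := j.isLt
    have hr := r.isLt
    calc (j : ℕ) * k + (r : ℕ) < ((j : ℕ) + 1) * k := by nlinarith
      _ ≤ k ^ d * k := Nat.mul_le_mul_right _ (by omega)
      _ = k ^ (d + 1) := (pow_succ k d).symm⟩⟩

/-- A node-value vector is consistent if every internal node's value equals the sum of
its children's values. -/
def Consistent {k ℓ : ℕ} (t : TreeNode k ℓ → ℝ) : Prop :=
  ∀ (d : ℕ) (hd : d + 1 < ℓ) (j : Fin (k ^ d)),
    t (mkNode d (by omega) j) = ∑ r : Fin k, t (childNode d hd j r)

/-- The leaves of the subtree rooted at `v`. -/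
def subtreeLeaves {k ℓ : ℕ} (v : TreeNode k ℓ) : Finset (Fin (k ^ (ℓ - 1))) :=
  Finset.univ.filter fun u => (u : ℕ) / k ^ (ℓ - 1 - (v.1 : ℕ)) = (v.2 : ℕ)

/-- The consistent node counts induced by leaf counts `x`: `H(x)[v] = Σ_{u ∈ leaves(v)} x[u]`. -/
noncomputable def Hfun {k ℓ : ℕ} (x : Fin (k ^ (ℓ - 1)) → ℝ) (v : TreeNode k ℓ) : ℝ :=
  ∑ u ∈ subtreeLeaves v, x u

/-- The Laplace measure on `ℝ` with scale `b`: density `x ↦ (1/(2b))·exp(−|x|/b)`. -/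
noncomputable def laplaceMeasure (b : ℝ) : Measure ℝ :=
  volume.withDensity fun x => ENNReal.ofReal ((2 * b)⁻¹ * Real.exp (-|x| / b))

/-- I.i.d. Laplace noise with scale `b`, one coordinate for each node of the tree. -/
noncomputable def treeNoise (k ℓ : ℕ) (b : ℝ) : Measure (TreeNode k ℓ → ℝ) :=
  Measure.pi fun _ => laplaceMeasure b

lemma integral_abs_pow_mul_exp_neg_abs_div (n : ℕ) {b : ℝ} (hb : 0 < b) :
    ∫ x : ℝ, |x| ^ n * Real.exp (-|x| / b) = 2 * (b ^ (n + 1) * n.factorial) := by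
  rw [integral_comp_abs (f := fun x : ℝ => x ^ n * Real.exp (-x / b))]
  have h := Real.integral_rpow_mul_exp_neg_mul_Ioi (a := n + 1) (r := b⁻¹) (by positivity)
    (by positivity)
  rw [Real.Gamma_nat_eq_factorial, one_div, inv_inv] at h
  rw [← Real.rpow_natCast b (n + 1), Nat.cast_succ, ← h]
  congr 1
  refine setIntegral_congr_fun measurableSet_Ioi fun x _ => ?_
  simp only [add_sub_cancel_right, Real.rpow_natCast]
  congr 2
  ring

lemma integrable_abs_pow_mul_exp_neg_abs_div (n : ℕ) {b : ℝ} (hb : 0 < b) :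
    Integrable fun x : ℝ => |x| ^ n * Real.exp (-|x| / b) := by
  refine Integrable.of_integral_ne_zero ?_
  rw [integral_abs_pow_mul_exp_neg_abs_div n hb]
  positivity

lemma isProbabilityMeasure_laplaceMeasure {b : ℝ} (hb : 0 < b) :
    IsProbabilityMeasure (laplaceMeasure b) := by
  constructor
  rw [laplaceMeasure, withDensity_apply _ MeasurableSet.univ, Measure.restrict_univ,
    ← ofReal_integral_eq_lintegral_ofReal]
  · have h := integral_abs_pow_mul_exp_neg_abs_div 0 hb
    simp only [pow_zero, one_mul] at h
    rw [integral_const_mul, h, ENNReal.ofReal_eq_one]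
    simp only [zero_add, pow_one, Nat.factorial_zero, Nat.cast_one, mul_one]
    exact inv_mul_cancel₀ (by positivity)
  · simpa using (integrable_abs_pow_mul_exp_neg_abs_div 0 hb).const_mul (2 * b)⁻¹
  · exact .of_forall fun x => by positivity

lemma integral_laplaceMeasure {b : ℝ} (hb : 0 < b) (f : ℝ → ℝ) :
    ∫ x, f x ∂laplaceMeasure b = ∫ x, (2 * b)⁻¹ * Real.exp (-|x| / b) * f x := by
  rw [laplaceMeasure, integral_withDensity_eq_integral_toReal_smul (by fun_prop) (by simp)]
  refine integral_congr_ae (.of_forall fun x => ?_)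
  simp only [smul_eq_mul]
  rw [ENNReal.toReal_ofReal (by positivity)]

lemma integral_id_laplaceMeasure {b : ℝ} (hb : 0 < b) : ∫ x, x ∂laplaceMeasure b = 0 := by
  rw [integral_laplaceMeasure hb]
  have h := integral_neg_eq_self (fun x : ℝ => (2 * b)⁻¹ * Real.exp (-|x| / b) * x) volume
  simp only [abs_neg, mul_neg, integral_neg] at h
  linarith

lemma integral_sq_laplaceMeasure {b : ℝ} (hb : 0 < b) :
    ∫ x, x ^ 2 ∂laplaceMeasure b = 2 * b ^ 2 := by
  rw [integral_laplaceMeasure hb]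
  have h := integral_abs_pow_mul_exp_neg_abs_div 2 hb
  simp only [sq_abs] at h
  simp only [mul_assoc, integral_const_mul, mul_comm (Real.exp _), h, Nat.factorial_two]
  push_cast
  field_simp

lemma memLp_id_laplaceMeasure {b : ℝ} (hb : 0 < b) :
    MemLp (fun x => x) 2 (laplaceMeasure b) := by
  rw [memLp_two_iff_integrable_sq (by fun_prop)]
  refine Integrable.of_integral_ne_zero ?_
  rw [integral_sq_laplaceMeasure hb]
  positivity

open ProbabilityTheory in
lemma integral_sq_sum_mul_pi_laplaceMeasure {ι : Type*} [Fintype ι] {b : ℝ} (hb : 0 < b)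
    (p : ι → ℝ) :
    ∫ ω, (∑ v, p v * ω v) ^ 2 ∂(Measure.pi fun _ : ι => laplaceMeasure b)
      = 2 * b ^ 2 * ∑ v, p v ^ 2 := by
  have := isProbabilityMeasure_laplaceMeasure hb
  have hL (v : ι) : MemLp (fun x => p v * x) 2 (laplaceMeasure b) :=
    (memLp_id_laplaceMeasure hb).const_mul (p v)
  have hv := variance_sum_pi hL
  have hvar (v : ι) : Var[fun x => p v * x; laplaceMeasure b] = p v ^ 2 * (2 * b ^ 2) := by
    rw [variance_of_integral_eq_zero (by fun_prop)]
    · simp only [mul_pow, integral_const_mul, integral_sq_laplaceMeasure hb]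
    · rw [integral_const_mul, integral_id_laplaceMeasure hb, mul_zero]
  rw [variance_of_integral_eq_zero (by fun_prop)] at hv
  · simp only [hvar, ← Finset.sum_mul, Finset.sum_apply] at hv
    rw [hv, mul_comm]
  · simp only [Finset.sum_apply]
    rw [integral_finsetSum _ fun v _ => integrable_comp_eval ((hL v).integrable (by norm_num))]
    refine Finset.sum_eq_zero fun v _ => ?_
    rw [integral_const_mul, integral_eval, integral_id_laplaceMeasure hb, mul_zero]

lemma sum_range_mul_div {M : Type*} [AddCommMonoid M] (f : ℕ → M) (m k : ℕ) :
    ∑ i ∈ Finset.range (m * k), f i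
      = ∑ j ∈ Finset.range m, ∑ r ∈ Finset.range k, f (j * k + r) := by
  induction m with
  | zero => simp
  | succ m ih => rw [Nat.succ_mul, Finset.sum_range_add, ih, Finset.sum_range_succ]

/-- The coefficients by which the level-`d` weights `W d` differ from the weights that the
nodes of level `d` inherit from their parents. -/
def levelIncrement (k : ℕ) (W : ℕ → ℕ → ℝ) : ℕ → ℕ → ℝ
  | 0, i => W 0 i
  | d + 1, i => W (d + 1) i - W d (i / k)

lemma sum_levelIncrement_mul {k : ℕ} (W T : ℕ → ℕ → ℝ) (n : ℕ)
    (hT : ∀ d < n, ∀ j < k ^ d, T d j = ∑ r ∈ Finset.range k, T (d + 1) (j * k + r)) :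
    ∑ d ∈ Finset.range (n + 1), ∑ i ∈ Finset.range (k ^ d), levelIncrement k W d i * T d i
      = ∑ i ∈ Finset.range (k ^ n), W n i * T n i := by
  induction n with
  | zero => simp [levelIncrement]
  | succ n ih =>
    rw [Finset.sum_range_succ, ih fun d hd => hT d (by omega)]
    have h : ∑ i ∈ Finset.range (k ^ n), W n i * T n i
        = ∑ i ∈ Finset.range (k ^ (n + 1)), W n (i / k) * T (n + 1) i := by
      rw [pow_succ, sum_range_mul_div]
      refine Finset.sum_congr rfl fun j hj => ?_
      rw [hT n (by omega) j (Finset.mem_range.1 hj), Finset.mul_sum]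
      refine Finset.sum_congr rfl fun r hr => ?_
      have hr := Finset.mem_range.1 hr
      rw [mul_comm j k, Nat.mul_add_div (by omega), Nat.div_eq_of_lt hr, add_zero]
    rw [h, ← Finset.sum_add_distrib]
    refine Finset.sum_congr rfl fun i _ => ?_
    simp only [levelIncrement]
    ring

/-- The indicator of `{i | i < p}` with the value `θ` at the endpoint `p`. -/
noncomputable def prefixWeight (θ : ℝ) (p i : ℕ) : ℝ :=
  if i < p then 1 else if i = p then θ else 0

lemma sq_prefixWeight_sub_le {k : ℕ} {θ : ℝ} (h0 : 0 ≤ θ) (h1 : θ ≤ 1) (p i : ℕ) :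
    (prefixWeight θ p i - prefixWeight (1 / 2) (p / k) (i / k)) ^ 2
      ≤ if i / k = p / k then 1 / 4 else 0 := by
  by_cases h : i / k = p / k
  · have h' : prefixWeight (1 / 2) (p / k) (i / k) = 1 / 2 := by simp [prefixWeight, h]
    rw [if_pos h, h']
    unfold prefixWeight
    split_ifs <;> nlinarith
  · rw [if_neg h]
    unfold prefixWeight
    rcases lt_or_gt_of_ne h with h' | h'
    · have : i < p := by
        by_contra! hc
        exact absurd (Nat.div_le_div_right (c := k) hc) (by omega)
      simp [h', this]
    · have : p < i := by
        by_contra! hc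
        exact absurd (Nat.div_le_div_right (c := k) hc) (by omega)
      simp [h'.not_gt, h, this.not_gt, this.ne']

lemma card_filter_div_eq_le {k : ℕ} (hk : 0 < k) (m q : ℕ) :
    ((Finset.range m).filter fun i => i / k = q).card ≤ k := by
  calc _ ≤ (Finset.Ico (q * k) (q * k + k)).card := by
        refine Finset.card_le_card fun i hi => ?_
        rw [Finset.mem_filter, Nat.div_eq_iff hk] at hi
        rw [Finset.mem_Ico]
        omega
    _ = k := by simp

lemma sum_sq_prefixWeight_sub_le {k : ℕ} (hk : 0 < k) {θ : ℝ} (h0 : 0 ≤ θ) (h1 : θ ≤ 1)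
    (m p : ℕ) :
    ∑ i ∈ Finset.range m, (prefixWeight θ p i - prefixWeight (1 / 2) (p / k) (i / k)) ^ 2
      ≤ (k : ℝ) / 4 := by
  calc _ ≤ ∑ i ∈ Finset.range m, if i / k = p / k then (1 / 4 : ℝ) else 0 :=
        Finset.sum_le_sum fun i _ => sq_prefixWeight_sub_le h0 h1 p i
    _ = ((Finset.range m).filter fun i => i / k = p / k).card * (1 / 4 : ℝ) := by
        rw [← Finset.sum_filter, Finset.sum_const, nsmul_eq_mul]
    _ ≤ (k : ℝ) / 4 := by
        have : (((Finset.range m).filter fun i => i / k = p / k).card : ℝ) ≤ k :=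
          mod_cast card_filter_div_eq_le hk m (p / k)
        linarith

/-- Weights for the leaf interval `[a, b]`, in a tree whose leaves have depth `n`: the indicator
of `[a, b]` at depth `n`; above it, the ancestors of the endpoints carry half weight. -/
noncomputable def rangeWeight (k n a b d i : ℕ) : ℝ :=
  prefixWeight (if d = n then 1 else 1 / 2) (b / k ^ (n - d)) i
    - prefixWeight (if d = n then 0 else 1 / 2) (a / k ^ (n - d)) i

lemma rangeWeight_self {k n a b : ℕ} (hab : a ≤ b) (i : ℕ) :
    rangeWeight k n a b n i = if i ∈ Finset.Icc a b then 1 else 0 := by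
  simp only [rangeWeight, prefixWeight, Finset.mem_Icc, if_true, Nat.sub_self, pow_zero,
    Nat.div_one]
  split_ifs <;> first | omega | norm_num

lemma sum_sq_levelIncrement_rangeWeight_le {k n a b : ℕ} (hk : 0 < k) (ha : a < k ^ n)
    (hb : b < k ^ n) (d : ℕ) (hd : d ≤ n) :
    ∑ i ∈ Finset.range (k ^ d), levelIncrement k (rangeWeight k n a b) d i ^ 2 ≤ (k : ℝ) := by
  have hk' : (1 : ℝ) ≤ k := mod_cast hk
  cases d with
  | zero =>
    simp only [levelIncrement, rangeWeight, prefixWeight, pow_zero, Finset.sum_range_one,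
      Nat.sub_zero, Nat.div_eq_of_lt ha, Nat.div_eq_of_lt hb]
    split_ifs <;> nlinarith
  | succ d =>
    have hp (u : ℕ) : u / k ^ (n - d) = u / k ^ (n - (d + 1)) / k := by
      rw [Nat.div_div_eq_div_mul, ← pow_succ]
      congr 2
      omega
    have hdn : d ≠ n := by omega
    simp only [levelIncrement, rangeWeight, hp, if_neg hdn]
    set p := b / k ^ (n - (d + 1))
    set q := a / k ^ (n - (d + 1))
    set θ : ℝ := if d + 1 = n then 1 else 1 / 2 with hθ
    set φ : ℝ := if d + 1 = n then 0 else 1 / 2 with hφ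
    have h1 := sum_sq_prefixWeight_sub_le hk (θ := θ) (by rw [hθ]; split_ifs <;> norm_num)
      (by rw [hθ]; split_ifs <;> norm_num) (k ^ (d + 1)) p
    have h2 := sum_sq_prefixWeight_sub_le hk (θ := φ) (by rw [hφ]; split_ifs <;> norm_num)
      (by rw [hφ]; split_ifs <;> norm_num) (k ^ (d + 1)) q
    calc _ ≤ ∑ i ∈ Finset.range (k ^ (d + 1)),
          (2 * (prefixWeight θ p i - prefixWeight (1 / 2) (p / k) (i / k)) ^ 2
            + 2 * (prefixWeight φ q i - prefixWeight (1 / 2) (q / k) (i / k)) ^ 2) := by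
          refine Finset.sum_le_sum fun i _ => ?_
          nlinarith [sq_nonneg ((prefixWeight θ p i - prefixWeight (1 / 2) (p / k) (i / k))
            + (prefixWeight φ q i - prefixWeight (1 / 2) (q / k) (i / k)))]
      _ ≤ (k : ℝ) := by
          rw [Finset.sum_add_distrib, ← Finset.mul_sum, ← Finset.mul_sum]
          linarith

/-- A node-value vector as a function of depth and index, extended by zero. -/
noncomputable def nodeValue {k ℓ : ℕ} (t : TreeNode k ℓ → ℝ) (d i : ℕ) : ℝ :=
  if h : ∃ _ : d < ℓ, i < k ^ d then t (mkNode d h.1 ⟨i, h.2⟩) else 0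

lemma nodeValue_mk {k ℓ : ℕ} (t : TreeNode k ℓ → ℝ) (d : Fin ℓ) (i : Fin (k ^ (d : ℕ))) :
    nodeValue t d i = t ⟨d, i⟩ := by
  rw [nodeValue, dif_pos ⟨d.2, i.2⟩]
  rfl

lemma nodeValue_eq_sum_of_consistent {k ℓ : ℕ} {t : TreeNode k ℓ → ℝ} (ht : Consistent t)
    {d : ℕ} (hd : d + 1 < ℓ) {j : ℕ} (hj : j < k ^ d) :
    nodeValue t d j = ∑ r ∈ Finset.range k, nodeValue t (d + 1) (j * k + r) := by
  rw [Finset.sum_range]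
  calc nodeValue t d j = t (mkNode d (by omega) ⟨j, hj⟩) :=
        nodeValue_mk t ⟨d, by omega⟩ ⟨j, hj⟩
    _ = ∑ r : Fin k, t (childNode d hd ⟨j, hj⟩ r) := ht d hd ⟨j, hj⟩
    _ = _ := Finset.sum_congr rfl fun r _ =>
        (nodeValue_mk t (childNode d hd ⟨j, hj⟩ r).1 (childNode d hd ⟨j, hj⟩ r).2).symm

lemma sum_treeNode {k ℓ : ℕ} (f : ℕ → ℕ → ℝ) :
    ∑ v : TreeNode k ℓ, f v.1 v.2
      = ∑ d ∈ Finset.range ℓ, ∑ i ∈ Finset.range (k ^ d), f d i := by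
  rw [Fintype.sum_sigma, Finset.sum_range]
  exact Finset.sum_congr rfl fun d _ => (Finset.sum_range (f d)).symm

/-- A linear form on node-value vectors that agrees with the range query `[a, b]` on the
consistent ones. -/
noncomputable def rangeCoeff {k ℓ : ℕ} (a b : Fin (k ^ (ℓ - 1))) (v : TreeNode k ℓ) : ℝ :=
  levelIncrement k (rangeWeight k (ℓ - 1) a b) v.1 v.2

lemma sum_rangeCoeff_mul {k ℓ : ℕ} (hℓ : ℓ - 1 < ℓ) {a b : Fin (k ^ (ℓ - 1))} (hab : a ≤ b)
    {t : TreeNode k ℓ → ℝ} (ht : Consistent t) :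
    ∑ v, rangeCoeff a b v * t v
      = ∑ u ∈ Finset.Icc a b, t (mkNode (ℓ - 1) hℓ u) := by
  have hsum := sum_levelIncrement_mul (rangeWeight k (ℓ - 1) a b) (nodeValue t) (ℓ - 1)
    fun d hd j hj => nodeValue_eq_sum_of_consistent ht (by omega) hj
  rw [Nat.sub_add_cancel (by omega)] at hsum
  calc ∑ v, rangeCoeff a b v * t v
      = ∑ v : TreeNode k ℓ,
          levelIncrement k (rangeWeight k (ℓ - 1) a b) v.1 v.2 * nodeValue t v.1 v.2 :=
        Finset.sum_congr rfl fun v _ => by rw [nodeValue_mk]; rfl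
    _ = _ := by
      rw [sum_treeNode (fun d i =>
        levelIncrement k (rangeWeight k (ℓ - 1) a b) d i * nodeValue t d i), hsum,
        Finset.sum_range, ← Finset.sum_subset (Finset.subset_univ (Finset.Icc a b))]
      · refine Finset.sum_congr rfl fun u hu => ?_
        rw [rangeWeight_self hab, if_pos (by simpa using hu), one_mul]
        exact nodeValue_mk t ⟨ℓ - 1, hℓ⟩ u
      · intro u _ hu
        rw [rangeWeight_self hab, if_neg (by simpa using hu), zero_mul]

lemma sum_sq_rangeCoeff_le {k ℓ : ℕ} (hk : 0 < k) (a b : Fin (k ^ (ℓ - 1))) :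
    ∑ v, rangeCoeff a b v ^ 2 ≤ (k : ℝ) * ℓ := by
  unfold rangeCoeff
  rw [sum_treeNode (fun d i => levelIncrement k (rangeWeight k (ℓ - 1) a b) d i ^ 2)]
  calc _ ≤ ∑ d ∈ Finset.range ℓ, (k : ℝ) := by
        refine Finset.sum_le_sum fun d hd => ?_
        have := Finset.mem_range.1 hd
        exact sum_sq_levelIncrement_rangeWeight_le hk a.2 b.2 d (by omega)
    _ = k * ℓ := by simp [mul_comm]

lemma Consistent.add {k ℓ : ℕ} {s t : TreeNode k ℓ → ℝ} (hs : Consistent s)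
    (ht : Consistent t) : Consistent (s + t) := fun d hd j => by
  simp only [Pi.add_apply, Finset.sum_add_distrib, hs d hd j, ht d hd j]

lemma Consistent.smul {k ℓ : ℕ} {t : TreeNode k ℓ → ℝ} (ht : Consistent t) (c : ℝ) :
    Consistent (c • t) := fun d hd j => by
  simp only [Pi.smul_apply, smul_eq_mul, ← Finset.mul_sum, ht d hd j]

lemma Hfun_eq_sum_ite {k ℓ : ℕ} (x : Fin (k ^ (ℓ - 1)) → ℝ) (v : TreeNode k ℓ) :
    Hfun x v = ∑ u : Fin (k ^ (ℓ - 1)),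
      if (u : ℕ) / k ^ (ℓ - 1 - (v.1 : ℕ)) = (v.2 : ℕ) then x u else 0 :=
  Finset.sum_filter _ _

lemma consistent_Hfun {k ℓ : ℕ} (hk : 0 < k) (x : Fin (k ^ (ℓ - 1)) → ℝ) :
    Consistent (Hfun x) := by
  intro d hd j
  simp only [Hfun_eq_sum_ite, mkNode, childNode]
  rw [Finset.sum_comm]
  refine Finset.sum_congr rfl fun u _ => ?_
  have hp : (u : ℕ) / k ^ (ℓ - 1 - d) = (u : ℕ) / k ^ (ℓ - 1 - (d + 1)) / k := by
    rw [Nat.div_div_eq_div_mul, ← pow_succ]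
    congr 2
    omega
  rw [hp]
  set w := (u : ℕ) / k ^ (ℓ - 1 - (d + 1))
  split_ifs with h
  · rw [Finset.sum_eq_single ⟨w % k, Nat.mod_lt _ hk⟩]
    · rw [if_pos]
      rw [← h, mul_comm]
      exact (Nat.div_add_mod w k).symm
    · intro r _ hr
      refine if_neg fun hw => hr (Fin.ext ?_)
      have hw' : w = j * k + r := hw
      change (r : ℕ) = w % k
      rw [hw', mul_comm, Nat.mul_add_mod, Nat.mod_eq_of_lt r.2]
    · simp
  · refine (Finset.sum_eq_zero fun r _ => if_neg fun hw => h ?_).symm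
    rw [hw, mul_comm, Nat.mul_add_div hk, Nat.div_eq_of_lt r.2, add_zero]

lemma Hfun_leaf {k ℓ : ℕ} (hℓ : ℓ - 1 < ℓ) (x : Fin (k ^ (ℓ - 1)) → ℝ)
    (u : Fin (k ^ (ℓ - 1))) : Hfun x (mkNode (ℓ - 1) hℓ u) = x u := by
  simp [Hfun, subtreeLeaves, mkNode, Fin.val_inj, Finset.filter_eq']

/-- The residual of a least squares approximation is orthogonal to the line it may move along. -/
lemma sum_sub_mul_eq_zero_of_forall_sum_sq_le {ι : Type*} [Fintype ι] {y g s : ι → ℝ}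
    (h : ∀ c : ℝ, ∑ v, (y v - g v) ^ 2 ≤ ∑ v, ((y + c • s) v - g v) ^ 2) :
    ∑ v, (y v - g v) * s v = 0 := by
  set B := ∑ v, (y v - g v) * s v with hB
  set A := ∑ v, s v ^ 2 with hA
  have hA0 : 0 ≤ A := Finset.sum_nonneg fun v _ => sq_nonneg _
  have key (c : ℝ) : 0 ≤ 2 * c * B + c ^ 2 * A := by
    have hc : ∑ v, ((y + c • s) v - g v) ^ 2
        = ∑ v, (y v - g v) ^ 2 + (2 * c * B + c ^ 2 * A) := by
      rw [hA, hB, Finset.mul_sum, Finset.mul_sum, ← Finset.sum_add_distrib,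
        ← Finset.sum_add_distrib]
      refine Finset.sum_congr rfl fun v _ => ?_
      simp only [Pi.add_apply, Pi.smul_apply, smul_eq_mul]
      ring
    linarith [h c]
  have h1 := key (-(B / (A + 1)))
  have h2 : 2 * -(B / (A + 1)) * B + (-(B / (A + 1))) ^ 2 * A
      = -(B ^ 2 * (A + 2) / (A + 1) ^ 2) := by
    field_simp
    ring
  rw [h2] at h1
  by_contra hne
  have : 0 < B ^ 2 * (A + 2) / (A + 1) ^ 2 := by positivity
  linarith

/-- **Error of constrained inference for range queries.**
With `h̃ = H(x) + η` where `η` is i.i.d. `Laplace(ℓ/ε)` noise (variance `2ℓ²/ε²`),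
and `h̄` the minimum `L₂` consistent solution for `h̃`, every range query `q` over a
contiguous interval `[a,b]` of leaves satisfies
`E[(h̄_q − q(x))²] ≤ kℓ·(2ℓ²/ε²) = 2kℓ³/ε²`. -/
theorem tree_inference_range_query_error (k ℓ : ℕ) (hk : 2 ≤ k) (hℓ : 1 ≤ ℓ)
    (ε : ℝ) (hε : 0 < ε)
    (x : Fin (k ^ (ℓ - 1)) → ℝ)
    (hbar : (TreeNode k ℓ → ℝ) → TreeNode k ℓ → ℝ)
    (hbar_cons : ∀ g, Consistent (hbar g))
    (hbar_min : ∀ g t, Consistent t → ∑ v, (hbar g v - g v) ^ 2 ≤ ∑ v, (t v - g v) ^ 2)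
    (a b : Fin (k ^ (ℓ - 1))) (hab : a ≤ b) :
    (∫ ω, ((∑ u ∈ Finset.Icc a b, hbar (fun w => Hfun x w + ω w) (mkNode (ℓ - 1) (by omega) u))
          - ∑ u ∈ Finset.Icc a b, x u) ^ 2 ∂(treeNoise k ℓ ((ℓ : ℝ) / ε)))
      ≤ (k : ℝ) * ℓ * (2 * (ℓ : ℝ) ^ 2 / ε ^ 2) := by
  have hk0 : 0 < k := by omega
  have horth (g s : TreeNode k ℓ → ℝ) (hs : Consistent s) : ∑ v, (hbar g v - g v) * s v = 0 :=
    sum_sub_mul_eq_zero_of_forall_sum_sq_le fun c =>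
      hbar_min g _ ((hbar_cons g).add (hs.smul c))
  set p := hbar (rangeCoeff a b)
  have herr (ω : TreeNode k ℓ → ℝ) :
      (∑ u ∈ Finset.Icc a b, hbar (fun w => Hfun x w + ω w) (mkNode (ℓ - 1) (by omega) u))
        - ∑ u ∈ Finset.Icc a b, x u = ∑ v, p v * ω v := by
    set y := hbar (fun w => Hfun x w + ω w) + (-1 : ℝ) • Hfun x with hy
    have hycons : Consistent y := (hbar_cons _).add ((consistent_Hfun hk0 x).smul _)
    have h1 := sum_rangeCoeff_mul (Nat.sub_lt hℓ one_pos) hab hycons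
    have h2 := horth (rangeCoeff a b) y hycons
    have h3 := horth (fun w => Hfun x w + ω w) p (hbar_cons _)
    simp only [sub_mul, Finset.sum_sub_distrib] at h2
    have h4 : ∑ v, (hbar (fun w => Hfun x w + ω w) v - (Hfun x v + ω v)) * p v
        = ∑ v, p v * y v - ∑ v, p v * ω v := by
      rw [← Finset.sum_sub_distrib]
      refine Finset.sum_congr rfl fun v _ => ?_
      simp only [hy, Pi.add_apply, Pi.smul_apply, smul_eq_mul]
      ring
    have h5 : ∑ u ∈ Finset.Icc a b, y (mkNode (ℓ - 1) (by omega) u)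
        = (∑ u ∈ Finset.Icc a b, hbar (fun w => Hfun x w + ω w) (mkNode (ℓ - 1) (by omega) u))
          - ∑ u ∈ Finset.Icc a b, x u := by
      rw [← Finset.sum_sub_distrib]
      refine Finset.sum_congr rfl fun u _ => ?_
      simp only [hy, Pi.add_apply, Pi.smul_apply, smul_eq_mul, Hfun_leaf]
      ring
    linarith
  have hp : ∑ v, p v ^ 2 ≤ ∑ v, rangeCoeff a b v ^ 2 := by
    have h := horth (rangeCoeff a b) p (hbar_cons _)
    have h' : ∑ v, rangeCoeff a b v ^ 2 = ∑ v, p v ^ 2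
        + (∑ v, (p v - rangeCoeff a b v) ^ 2 - 2 * ∑ v, (p v - rangeCoeff a b v) * p v) := by
      rw [Finset.mul_sum, ← Finset.sum_sub_distrib, ← Finset.sum_add_distrib]
      refine Finset.sum_congr rfl fun v _ => ?_
      ring
    have : 0 ≤ ∑ v, (p v - rangeCoeff a b v) ^ 2 := Finset.sum_nonneg fun v _ => sq_nonneg _
    rw [h', h]
    linarith
  have hb : 0 < (ℓ : ℝ) / ε := div_pos (by exact_mod_cast hℓ) hε
  simp only [herr]
  rw [treeNoise, integral_sq_sum_mul_pi_laplaceMeasure hb, div_pow, ← mul_div_assoc, mul_comm]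
  exact mul_le_mul_of_nonneg_right (hp.trans (sum_sq_rangeCoeff_le hk0 a b)) (by positivity)
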